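/- arXiv:1201.5084 — 2 statements merged into one kernel-verified Lean document; each statement's English description precedes it below -/
import Mathlib

section
/- Let H be in (1/2, 1) and fix 0 ≤ u < v ≤ s < t. Define g(τ) = R_H(v, t+τ) - R_H(v, s+τ) - R_H(u, t+τ) + R_H(u, s+τ) (the covariance E(ξ^H_v - ξ^H_u)(ξ^H_{t+τ} - ξ^H_{s+τ}) of increments of ofBm). Then 0 < liminf_{τ→∞} τ^{2-2H} g(τ) ≤ limsup_{τ→∞} τ^{2-2H} g(τ) < ∞. -/
open Real Filter

/-- The oscillatory function `h_t = Σ_{j∈ℤ} (b a^j t)^{-2H} (e^{-b a^j t} - 1 + b a^j t)`. -/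
noncomputable def hosc (a b H t : ℝ) : ℝ :=
  ∑' j : ℤ, (b * a ^ j * t) ^ (-(2 * H)) *
    (Real.exp (-(b * a ^ j * t)) - 1 + b * a ^ j * t)

/-- The oscillatory fractional Brownian motion covariance `R_H(s,t)`. -/
noncomputable def Rcov (a b H s t : ℝ) : ℝ :=
  (1 / 2) * (s ^ (2 * H) * hosc a b H s + t ^ (2 * H) * hosc a b H t
    - |s - t| ^ (2 * H) * hosc a b H |s - t|)

/-- The covariance of increments `E(ξ_v - ξ_u)(ξ_{t+τ} - ξ_{s+τ})` for a centered Gaussian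
process with covariance `P`. -/
noncomputable def incCov (P : ℝ → ℝ → ℝ) (u v s t τ : ℝ) : ℝ :=
  P v (t + τ) - P v (s + τ) - P u (t + τ) + P u (s + τ)

lemma aux_series (a p q C : ℝ) (ha0 : 0 < a) (ha1 : a < 1) (hp : 0 < p) (hq : 0 < q) (hC : 0 ≤ C)
    (f : ℝ → ℝ) (hf0 : ∀ x, 0 < x → 0 ≤ f x) (hf1 : ∀ x, 0 < x → f x ≤ C * x ^ p)
    (hf2 : ∀ x, 0 < x → f x ≤ C * x ^ (-q)) :
    ∃ M : ℝ, ∀ x, 0 < x → Summable (fun j : ℤ => f (a ^ j * x)) ∧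
      ∑' j : ℤ, f (a ^ j * x) ≤ M := by
  set r := max (a ^ p) (a ^ q) with hr
  have hap : 0 < a ^ p := Real.rpow_pos_of_pos ha0 p
  have haq : 0 < a ^ q := Real.rpow_pos_of_pos ha0 q
  have hr0 : 0 ≤ r := le_max_of_le_left hap.le
  have hr1 : r < 1 := max_lt (Real.rpow_lt_one ha0.le ha1 hp) (Real.rpow_lt_one ha0.le ha1 hq)
  have hK : 1 ≤ a ^ (-q) := Real.one_le_rpow_of_pos_of_le_one_of_nonpos ha0 ha1.le (by linarith)
  have hsr : Summable (fun k : ℤ => C * a ^ (-q) * r ^ k.natAbs) := by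
    apply Summable.mul_left
    apply Summable.of_nat_of_neg
    · simpa using summable_geometric_of_lt_one hr0 hr1
    · simpa using summable_geometric_of_lt_one hr0 hr1
  refine ⟨∑' k : ℤ, C * a ^ (-q) * r ^ k.natAbs, fun x hx => ?_⟩
  obtain ⟨n, hn1, hn2⟩ := exists_mem_Ioc_zpow hx ((one_lt_inv₀ ha0).2 ha1)
  set y := a ^ (n + 1) * x with hy
  have hpos : 0 < a ^ (n + 1) := zpow_pos ha0 _
  have hy1 : y ≤ 1 := by
    rw [inv_zpow] at hn2
    calc y ≤ a ^ (n + 1) * (a ^ (n + 1))⁻¹ := by rw [hy]; gcongr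
      _ = 1 := mul_inv_cancel₀ hpos.ne'
  have hya : a ≤ y := by
    rw [inv_zpow] at hn1
    calc a = a ^ (n + 1) * (a ^ n)⁻¹ := by
          rw [zpow_add₀ ha0.ne', zpow_one]; field_simp
      _ ≤ y := by rw [hy]; gcongr
  have hy0 : 0 < y := lt_of_lt_of_le ha0 hya
  have hbd : ∀ k : ℤ, f (a ^ k * y) ≤ C * a ^ (-q) * r ^ k.natAbs := by
    intro k
    have hk : 0 < a ^ k * y := mul_pos (zpow_pos ha0 _) hy0
    obtain ⟨m, rfl | rfl⟩ := k.eq_nat_or_neg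
    · refine (hf1 _ hk).trans ?_
      rw [mul_assoc]
      refine mul_le_mul_of_nonneg_left ?_ hC
      rw [Real.mul_rpow (zpow_pos ha0 _).le hy0.le, zpow_natCast, Int.natAbs_natCast,
        ← Real.rpow_natCast_mul ha0.le, mul_comm (m : ℝ) p, Real.rpow_mul_natCast ha0.le]
      have h1 : y ^ p ≤ 1 := Real.rpow_le_one hy0.le hy1 hp.le
      have h2 : (a ^ p) ^ m ≤ r ^ m := pow_le_pow_left₀ hap.le (le_max_left _ _) m
      have h3 : 0 ≤ r ^ m := pow_nonneg hr0 m
      calc (a ^ p) ^ m * y ^ p ≤ r ^ m * 1 := by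
            apply mul_le_mul h2 h1 (Real.rpow_nonneg hy0.le _) h3
        _ ≤ a ^ (-q) * r ^ m := by nlinarith
    · refine (hf2 _ hk).trans ?_
      rw [mul_assoc]
      refine mul_le_mul_of_nonneg_left ?_ hC
      have e : (a ^ (-(m : ℤ))) ^ (-q) = (a ^ q) ^ m := by
        rw [← Real.rpow_intCast, ← Real.rpow_mul ha0.le, ← Real.rpow_mul_natCast ha0.le]
        congr 1; push_cast; ring
      rw [Real.mul_rpow (zpow_pos ha0 _).le hy0.le, Int.natAbs_neg, Int.natAbs_natCast, e]
      have h1 : y ^ (-q) ≤ a ^ (-q) :=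
        Real.rpow_le_rpow_of_nonpos ha0 hya (by linarith)
      have h2 : (a ^ q) ^ m ≤ r ^ m := pow_le_pow_left₀ haq.le (le_max_right _ _) m
      rw [mul_comm]
      exact mul_le_mul h1 h2 (pow_nonneg haq.le _) (by linarith)
  have hs : Summable (fun k : ℤ => f (a ^ k * y)) :=
    Summable.of_nonneg_of_le (fun k => hf0 _ (mul_pos (zpow_pos ha0 _) hy0)) hbd hsr
  have hre : (fun k : ℤ => f (a ^ k * y)) =
      (fun j : ℤ => f (a ^ j * x)) ∘ (Equiv.addRight (n + 1)) := by
    funext k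
    simp only [Function.comp, Equiv.coe_addRight, hy]
    rw [zpow_add₀ ha0.ne' k (n + 1), mul_assoc]
  constructor
  · rw [hre] at hs
    exact (Equiv.addRight (n + 1)).summable_iff.1 hs
  · rw [← (Equiv.addRight (n + 1)).tsum_eq (fun j : ℤ => f (a ^ j * x))]
    have := hs.tsum_le_tsum hbd hsr
    rw [hre] at this
    exact this

lemma aux_congr {f g : ℤ → ℝ} {x : ℝ} (h : ∀ j, f j = g j) (hg : HasSum g x) : HasSum f x := by
  rw [funext h]; exact hg

lemma phi_nonneg (x : ℝ) : 0 ≤ Real.exp (-x) - 1 + x := by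
  have := Real.add_one_le_exp (-x); linarith

lemma phi_le_sq (x : ℝ) (hx : 0 < x) : Real.exp (-x) - 1 + x ≤ x ^ 2 := by
  have h1 : 1 + x ≤ Real.exp x := by linarith [Real.add_one_le_exp x]
  have h2 : Real.exp (-x) * Real.exp x = 1 := by rw [← Real.exp_add]; simp
  have h3 := Real.exp_pos (-x)
  have h4 : Real.exp (-x) * (1 + x) ≤ 1 := by nlinarith
  by_contra h
  push Not at h
  nlinarith [pow_pos hx 3, mul_pos (sub_pos.2 h) (by linarith : 0 < 1 + x)]

lemma hosc_hasSum (a b H : ℝ) (ha0 : 0 < a) (ha1 : a < 1) (hb : 0 < b)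
    (hH1 : 1 / 2 < H) (hH2 : H < 1) (x : ℝ) (hx : 0 < x) :
    HasSum (fun j : ℤ => (b * a ^ j) ^ (-(2 * H)) *
      (Real.exp (-(b * a ^ j * x)) - 1 + b * a ^ j * x)) (x ^ (2 * H) * hosc a b H x) := by
  obtain ⟨M, hM⟩ := aux_series a (2 - 2 * H) (2 * H - 1) 1 ha0 ha1 (by linarith) (by linarith)
    zero_le_one (fun y => y ^ (-(2 * H)) * (Real.exp (-y) - 1 + y))
    (fun y hy => mul_nonneg (Real.rpow_nonneg hy.le _) (phi_nonneg y))
    (fun y hy => by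
      have : y ^ (2 - 2 * H) = y ^ (-(2 * H)) * y ^ 2 := by
        rw [← Real.rpow_natCast, ← Real.rpow_add hy]; congr 1; push_cast; ring
      rw [one_mul, this]
      exact mul_le_mul_of_nonneg_left (phi_le_sq y hy) (Real.rpow_nonneg hy.le _))
    (fun y hy => by
      have : y ^ (-(2 * H - 1)) = y ^ (-(2 * H)) * y := by
        nth_rewrite 3 [← Real.rpow_one y]
        rw [← Real.rpow_add hy]; congr 1; ring
      rw [one_mul, this]
      refine mul_le_mul_of_nonneg_left ?_ (Real.rpow_nonneg hy.le _)
      have : Real.exp (-y) ≤ 1 := Real.exp_le_one_iff.2 (by linarith)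
      linarith)
  have h1 := (hM (b * x) (mul_pos hb hx)).1.hasSum.mul_left (x ^ (2 * H))
  have h2 : ∀ j : ℤ, a ^ j * (b * x) = b * a ^ j * x := fun j => by ring
  simp only [h2] at h1
  unfold hosc
  refine aux_congr ?_ h1
  intro j
  have hc : 0 < b * a ^ j := mul_pos hb (zpow_pos ha0 _)
  rw [Real.mul_rpow hc.le hx.le, Real.rpow_neg hx.le]
  have := (Real.rpow_pos_of_pos hx (2 * H)).ne'
  field_simp

lemma incCov_hasSum (a b H : ℝ) (ha0 : 0 < a) (ha1 : a < 1) (hb : 0 < b)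
    (hH1 : 1 / 2 < H) (hH2 : H < 1)
    (u v s t : ℝ) (huv : u < v) (hvs : v ≤ s) (hst : s < t) (τ : ℝ) (hτ : 0 < τ) :
    HasSum (fun j : ℤ => (1 / 2) * ((b * a ^ j) ^ (-(2 * H)) *
      (Real.exp (-(b * a ^ j * (τ + (s - v)))) * ((1 - Real.exp (-(b * a ^ j * (t - s)))) *
       (1 - Real.exp (-(b * a ^ j * (v - u)))))))) (incCov (Rcov a b H) u v s t τ) := by
  have h := fun x hx => hosc_hasSum a b H ha0 ha1 hb hH1 hH2 x hx
  have h1 := h (t + τ - v) (by linarith)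
  have h2 := h (s + τ - v) (by linarith)
  have h3 := h (t + τ - u) (by linarith)
  have h4 := h (s + τ - u) (by linarith)
  have h5 := (((h2.sub h1).add h3).sub h4).mul_left (1 / 2)
  have e1 : |v - (t + τ)| = t + τ - v := by rw [abs_sub_comm, abs_of_pos (by linarith)]
  have e2 : |v - (s + τ)| = s + τ - v := by rw [abs_sub_comm, abs_of_pos (by linarith)]
  have e3 : |u - (t + τ)| = t + τ - u := by rw [abs_sub_comm, abs_of_pos (by linarith)]
  have e4 : |u - (s + τ)| = s + τ - u := by rw [abs_sub_comm, abs_of_pos (by linarith)]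
  have h6 : incCov (Rcov a b H) u v s t τ = 1 / 2 *
      ((s + τ - v) ^ (2 * H) * hosc a b H (s + τ - v) -
        (t + τ - v) ^ (2 * H) * hosc a b H (t + τ - v) +
          (t + τ - u) ^ (2 * H) * hosc a b H (t + τ - u) -
        (s + τ - u) ^ (2 * H) * hosc a b H (s + τ - u)) := by
    unfold incCov Rcov
    rw [e1, e2, e3, e4]; ring
  rw [h6]
  refine aux_congr ?_ h5
  · intro j
    set c := b * a ^ j
    have g1 : Real.exp (-(c * (t + τ - v))) =
      Real.exp (-(c * (τ + (s - v)))) * Real.exp (-(c * (t - s))) := by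
      rw [← Real.exp_add]; congr 1; ring
    have g2 : Real.exp (-(c * (s + τ - v))) = Real.exp (-(c * (τ + (s - v)))) := by
      congr 1; ring
    have g3 : Real.exp (-(c * (t + τ - u))) =
      Real.exp (-(c * (τ + (s - v)))) * Real.exp (-(c * (t - s))) * Real.exp (-(c * (v - u))) := by
      rw [← Real.exp_add, ← Real.exp_add]; congr 1; ring
    have g4 : Real.exp (-(c * (s + τ - u))) =
      Real.exp (-(c * (τ + (s - v)))) * Real.exp (-(c * (v - u))) := by
      rw [← Real.exp_add]; congr 1; ring
    rw [g1, g2, g3, g4]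
    ring

lemma upper_bd (a b H : ℝ) (ha0 : 0 < a) (ha1 : a < 1) (hb : 0 < b)
    (hH1 : 1 / 2 < H) (hH2 : H < 1)
    (u v s t : ℝ) (huv : u < v) (hvs : v ≤ s) (hst : s < t) :
    ∃ M : ℝ, ∀ τ : ℝ, 0 < τ → τ ^ (2 - 2 * H) * incCov (Rcov a b H) u v s t τ ≤ M := by
  obtain ⟨M, hM⟩ := aux_series a (2 - 2 * H) (2 * H) 2 ha0 ha1 (by linarith) (by linarith)
    zero_le_two (fun y => y ^ (2 - 2 * H) * Real.exp (-y))
    (fun y hy => mul_nonneg (Real.rpow_nonneg hy.le _) (Real.exp_pos _).le)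
    (fun y hy => by
      have h1 : Real.exp (-y) ≤ 1 := Real.exp_le_one_iff.2 (by linarith)
      have h2 := Real.rpow_nonneg hy.le (2 - 2 * H)
      nlinarith)
    (fun y hy => by
      have : y ^ (2 - 2 * H) = y ^ (-(2 * H)) * y ^ 2 := by
        rw [← Real.rpow_natCast, ← Real.rpow_add hy]; congr 1; push_cast; ring
      rw [this, mul_comm (2 : ℝ) (y ^ (-(2 * H))), mul_assoc]
      refine mul_le_mul_of_nonneg_left ?_ (Real.rpow_nonneg hy.le _)
      have h1 := Real.quadratic_le_exp_of_nonneg hy.le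
      rw [Real.exp_neg, ← div_eq_mul_inv, div_le_iff₀ (Real.exp_pos y)]
      linarith)
  refine ⟨(1 / 2) * ((t - s) * (v - u)) * M, fun τ hτ => ?_⟩
  have hs := (incCov_hasSum a b H ha0 ha1 hb hH1 hH2 u v s t huv hvs hst τ hτ).mul_left
    (τ ^ (2 - 2 * H))
  obtain ⟨hM1, hM2⟩ := hM (b * τ) (mul_pos hb hτ)
  have hAB : 0 ≤ (1 / 2) * ((t - s) * (v - u)) :=
    mul_nonneg (by norm_num) (mul_nonneg (by linarith) (by linarith))
  refine (hasSum_le ?_ hs (hM1.hasSum.mul_left ((1 / 2) * ((t - s) * (v - u))))).trans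
    (mul_le_mul_of_nonneg_left hM2 hAB)
  intro j
  have hc : 0 < b * a ^ j := mul_pos hb (zpow_pos ha0 _)
  have e : a ^ j * (b * τ) = b * a ^ j * τ := by ring
  simp only [e]
  generalize b * a ^ j = c at hc
  have k1 : Real.exp (-(c * (τ + (s - v)))) ≤ Real.exp (-(c * τ)) := by
    apply Real.exp_le_exp.2
    nlinarith [mul_nonneg hc.le (sub_nonneg.2 hvs)]
  have k2 : 1 - Real.exp (-(c * (t - s))) ≤ c * (t - s) := by
    linarith [Real.add_one_le_exp (-(c * (t - s)))]
  have k3 : 1 - Real.exp (-(c * (v - u))) ≤ c * (v - u) := by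
    linarith [Real.add_one_le_exp (-(c * (v - u)))]
  have p2 : 0 ≤ c * (t - s) := mul_nonneg hc.le (by linarith)
  have p3 : 0 ≤ c * (v - u) := mul_nonneg hc.le (by linarith)
  have k4 : 0 ≤ 1 - Real.exp (-(c * (v - u))) := by
    linarith [Real.exp_le_one_iff.2 (by linarith : -(c * (v - u)) ≤ 0)]
  have k5 : 0 ≤ 1 - Real.exp (-(c * (t - s))) := by
    linarith [Real.exp_le_one_iff.2 (by linarith : -(c * (t - s)) ≤ 0)]
  have k6 : Real.exp (-(c * (τ + (s - v)))) * ((1 - Real.exp (-(c * (t - s)))) *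
       (1 - Real.exp (-(c * (v - u))))) ≤
      Real.exp (-(c * τ)) * ((c * (t - s)) * (c * (v - u))) :=
    mul_le_mul k1 (mul_le_mul k2 k3 k4 p2) (mul_nonneg k5 k4) (Real.exp_pos _).le
  have hcc : c ^ (2 - 2 * H) = c ^ (-(2 * H)) * c ^ 2 := by
    rw [← Real.rpow_natCast, ← Real.rpow_add hc]; congr 1; push_cast; ring
  rw [Real.mul_rpow hc.le hτ.le, hcc]
  have w1 := Real.rpow_nonneg hτ.le (2 - 2 * H)
  have w2 := Real.rpow_nonneg hc.le (-(2 * H))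
  have := mul_le_mul_of_nonneg_left k6 (mul_nonneg w1 w2)
  linarith

lemma lower_bd (a b H : ℝ) (ha0 : 0 < a) (ha1 : a < 1) (hb : 0 < b)
    (hH1 : 1 / 2 < H) (hH2 : H < 1)
    (u v s t : ℝ) (huv : u < v) (hvs : v ≤ s) (hst : s < t) :
    ∃ m : ℝ, 0 < m ∧ ∀ τ : ℝ, t - u ≤ τ →
      m ≤ τ ^ (2 - 2 * H) * incCov (Rcov a b H) u v s t τ := by
  refine ⟨(1 / 2) * (a ^ (2 - 2 * H) * Real.exp (-2) * ((t - s) * (v - u))), ?_, ?_⟩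
  · have := Real.rpow_pos_of_pos ha0 (2 - 2 * H)
    have := Real.exp_pos (-2)
    have := mul_pos (sub_pos.2 hst) (sub_pos.2 huv)
    positivity
  intro τ hτu
  have hτ : 0 < τ := by linarith
  have hs := (incCov_hasSum a b H ha0 ha1 hb hH1 hH2 u v s t huv hvs hst τ hτ).mul_left
    (τ ^ (2 - 2 * H))
  obtain ⟨n, hn1, hn2⟩ := exists_mem_Ioc_zpow (mul_pos hb hτ) ((one_lt_inv₀ ha0).2 ha1)
  have hpos : 0 < a ^ (n + 1) := zpow_pos ha0 _
  have hy1 : b * a ^ (n + 1) * τ ≤ 1 := by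
    rw [inv_zpow] at hn2
    calc b * a ^ (n + 1) * τ = a ^ (n + 1) * (b * τ) := by ring
      _ ≤ a ^ (n + 1) * (a ^ (n + 1))⁻¹ := by gcongr
      _ = 1 := mul_inv_cancel₀ hpos.ne'
  have hya : a ≤ b * a ^ (n + 1) * τ := by
    rw [inv_zpow] at hn1
    calc a = a ^ (n + 1) * (a ^ n)⁻¹ := by
          rw [zpow_add₀ ha0.ne', zpow_one]; field_simp
      _ ≤ a ^ (n + 1) * (b * τ) := by gcongr
      _ = _ := by ring
  have hnn : ∀ j : ℤ, 0 ≤ τ ^ (2 - 2 * H) * ((1 / 2) * ((b * a ^ j) ^ (-(2 * H)) *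
      (Real.exp (-(b * a ^ j * (τ + (s - v)))) * ((1 - Real.exp (-(b * a ^ j * (t - s)))) *
       (1 - Real.exp (-(b * a ^ j * (v - u)))))))) := by
    intro j
    have hc : 0 < b * a ^ j := mul_pos hb (zpow_pos ha0 _)
    generalize b * a ^ j = c at hc
    have p2 : 0 ≤ c * (t - s) := mul_nonneg hc.le (by linarith)
    have p3 : 0 ≤ c * (v - u) := mul_nonneg hc.le (by linarith)
    have k4 : 0 ≤ 1 - Real.exp (-(c * (v - u))) := by
      linarith [Real.exp_le_one_iff.2 (by linarith : -(c * (v - u)) ≤ 0)]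
    have k5 : 0 ≤ 1 - Real.exp (-(c * (t - s))) := by
      linarith [Real.exp_le_one_iff.2 (by linarith : -(c * (t - s)) ≤ 0)]
    positivity
  refine le_trans ?_ (le_hasSum hs (n + 1) (fun j _ => hnn j))
  have hc : 0 < b * a ^ (n + 1) := mul_pos hb hpos
  generalize b * a ^ (n + 1) = c at hc hy1 hya
  have aux : ∀ x : ℝ, x * Real.exp (-x) ≤ 1 - Real.exp (-x) := by
    intro x
    have h1 := Real.add_one_le_exp x
    have h2 : Real.exp (-x) * Real.exp x = 1 := by rw [← Real.exp_add]; simp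
    have h3 := Real.exp_pos (-x)
    nlinarith
  have p2 : 0 ≤ c * (t - s) := mul_nonneg hc.le (by linarith)
  have p3 : 0 ≤ c * (v - u) := mul_nonneg hc.le (by linarith)
  have q2 := aux (c * (t - s))
  have q3 := aux (c * (v - u))
  have k7 : Real.exp (-2) ≤ Real.exp (-(c * (τ + (s - v)))) * (Real.exp (-(c * (t - s))) *
      Real.exp (-(c * (v - u)))) := by
    rw [← Real.exp_add, ← Real.exp_add]
    apply Real.exp_le_exp.2
    have := mul_le_mul_of_nonneg_left hτu hc.le
    nlinarith
  have k6 : Real.exp (-2) * ((c * (t - s)) * (c * (v - u))) ≤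
      Real.exp (-(c * (τ + (s - v)))) * ((1 - Real.exp (-(c * (t - s)))) *
       (1 - Real.exp (-(c * (v - u))))) := by
    calc _ ≤ (Real.exp (-(c * (τ + (s - v)))) * (Real.exp (-(c * (t - s))) *
      Real.exp (-(c * (v - u))))) * ((c * (t - s)) * (c * (v - u))) :=
          mul_le_mul_of_nonneg_right k7 (mul_nonneg p2 p3)
      _ = Real.exp (-(c * (τ + (s - v)))) * ((c * (t - s) * Real.exp (-(c * (t - s)))) *
          (c * (v - u) * Real.exp (-(c * (v - u))))) := by ring
      _ ≤ _ := by
        refine mul_le_mul_of_nonneg_left ?_ (Real.exp_pos _).le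
        exact mul_le_mul q2 q3 (mul_nonneg p3 (Real.exp_pos _).le)
          ((mul_nonneg p2 (Real.exp_pos _).le).trans q2)
  have hcc : c ^ (2 - 2 * H) = c ^ (-(2 * H)) * c ^ 2 := by
    rw [← Real.rpow_natCast, ← Real.rpow_add hc]; congr 1; push_cast; ring
  have w1 := Real.rpow_nonneg hτ.le (2 - 2 * H)
  have w2 := Real.rpow_nonneg hc.le (-(2 * H))
  have w3 := mul_le_mul_of_nonneg_left k6 (mul_nonneg w1 w2)
  have w4 : a ^ (2 - 2 * H) ≤ c ^ (-(2 * H)) * c ^ 2 * τ ^ (2 - 2 * H) := by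
    rw [← hcc, ← Real.mul_rpow hc.le hτ.le]
    exact Real.rpow_le_rpow ha0.le hya (by linarith)
  have w5 : 0 ≤ Real.exp (-2) * ((t - s) * (v - u)) :=
    mul_nonneg (Real.exp_pos _).le (mul_nonneg (by linarith) (by linarith))
  have w6 := mul_le_mul_of_nonneg_right w4 w5
  linarith

theorem stmt16 (a b : ℝ) (ha0 : 0 < a) (ha1 : a < 1) (hb : 0 < b)
    (H : ℝ) (hH1 : 1 / 2 < H) (hH2 : H < 1)
    (u v s t : ℝ) (hu : 0 ≤ u) (huv : u < v) (hvs : v ≤ s) (hst : s < t) :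
    0 < Filter.liminf
        (fun τ : ℝ => ((τ ^ (2 - 2 * H) * incCov (Rcov a b H) u v s t τ : ℝ) : EReal))
        Filter.atTop ∧
    Filter.liminf
        (fun τ : ℝ => ((τ ^ (2 - 2 * H) * incCov (Rcov a b H) u v s t τ : ℝ) : EReal))
        Filter.atTop
      ≤ Filter.limsup
        (fun τ : ℝ => ((τ ^ (2 - 2 * H) * incCov (Rcov a b H) u v s t τ : ℝ) : EReal))
        Filter.atTop ∧
    Filter.limsup
        (fun τ : ℝ => ((τ ^ (2 - 2 * H) * incCov (Rcov a b H) u v s t τ : ℝ) : EReal))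
        Filter.atTop < (⊤ : EReal) := by
  obtain ⟨M, hM⟩ := upper_bd a b H ha0 ha1 hb hH1 hH2 u v s t huv hvs hst
  obtain ⟨m, hm0, hm⟩ := lower_bd a b H ha0 ha1 hb hH1 hH2 u v s t huv hvs hst
  refine ⟨?_, Filter.liminf_le_limsup, ?_⟩
  · refine lt_of_lt_of_le (b := ((m : ℝ) : EReal)) (by exact_mod_cast hm0) ?_
    refine Filter.le_liminf_of_le (by isBoundedDefault) ?_
    filter_upwards [Filter.eventually_ge_atTop (t - u)] with τ hτ
    exact EReal.coe_le_coe_iff.2 (hm τ hτ)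
  · refine lt_of_le_of_lt (b := ((M : ℝ) : EReal)) ?_ (EReal.coe_lt_top M)
    refine Filter.limsup_le_of_le (by isBoundedDefault) ?_
    filter_upwards [Filter.eventually_gt_atTop (0 : ℝ)] with τ hτ
    exact EReal.coe_le_coe_iff.2 (hM τ hτ)
end

section
/- Fix T > 0 and H in (1/2, 1). For ε > 0 define I_ε(s,t) = (ε^{2H} h_ε)^{-1} [R_H(s+ε, t+ε) - R_H(s+ε, t) - R_H(s, t+ε) + R_H(s,t)] (the normalized covariance of increments of ofBm over [s, s+ε] and [t, t+ε]). Then lim_{ε→0+} ∫_0^T ∫_0^T I_ε(s,t)² ds dt = 0. (This is the key estimate showing that the normalized weighted quadratic variation h_ε^{-1} V_ε of ofBm converges to T in L².) -/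
open Real MeasureTheory Filter

/-- The normalized covariance of increments of ofBm over `[s, s+ε]` and `[t, t+ε]`:
`I_ε(s,t) = (ε^{2H} h_ε)⁻¹ E(ξ_{s+ε} - ξ_s)(ξ_{t+ε} - ξ_t)`. -/
noncomputable def Ieps (a b H ε s t : ℝ) : ℝ :=
  (ε ^ (2 * H) * hosc a b H ε)⁻¹ *
    (Rcov a b H (s + ε) (t + ε) - Rcov a b H (s + ε) t
      - Rcov a b H s (t + ε) + Rcov a b H s t)

noncomputable def gg (x : ℝ) : ℝ := Real.exp (-x) - 1 + x

lemma gg_nonneg (x : ℝ) : 0 ≤ gg x := by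
  unfold gg; linarith [Real.add_one_le_exp (-x)]

lemma gg_le_self {x : ℝ} (hx : 0 ≤ x) : gg x ≤ x := by
  unfold gg; linarith [Real.exp_le_one_iff.2 (neg_nonpos.2 hx)]

lemma gg_le_sq {x : ℝ} (hx : 0 ≤ x) : gg x ≤ x ^ 2 := by
  unfold gg
  have h1 : x + 1 ≤ Real.exp x := Real.add_one_le_exp x
  have h2 : Real.exp (-x) * Real.exp x = 1 := by rw [← Real.exp_add]; simp
  have h3 := Real.exp_pos (-x)
  have h4 : Real.exp (-x) * (x + 1) ≤ 1 := by
    refine le_of_le_of_eq ?_ h2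
    exact mul_le_mul_of_nonneg_left h1 h3.le
  by_contra hc
  push Not at hc
  have h5 : 1 - x + x ^ 2 < Real.exp (-x) := by linarith
  have h6 : (1 - x + x ^ 2) * (x + 1) < Real.exp (-x) * (x + 1) :=
    mul_lt_mul_of_pos_right h5 (by linarith)
  have h7 : (1 - x + x ^ 2) * (x + 1) = 1 + x ^ 3 := by ring
  have h8 : 0 ≤ x ^ 3 := by positivity
  linarith

lemma sq_le_gg {x : ℝ} (hx2 : x ≤ 2) : x ^ 2 / 4 ≤ gg x := by
  unfold gg
  have h1 : 1 - x / 2 ≤ Real.exp (-(x / 2)) := by linarith [Real.add_one_le_exp (-(x/2))]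
  have h2 : Real.exp (-x) = Real.exp (-(x / 2)) ^ 2 := by
    rw [← Real.exp_nat_mul]; congr 1; push_cast; ring
  rw [h2]
  nlinarith [pow_le_pow_left₀ (by linarith : (0:ℝ) ≤ 1 - x / 2) h1 2]

lemma one_sub_exp_sq_le {y : ℝ} (hy : 0 ≤ y) : (1 - Real.exp (-y)) ^ 2 ≤ y ^ 2 := by
  have h1 := Real.add_one_le_exp (-y)
  have h2 := Real.exp_le_one_iff.2 (neg_nonpos.2 hy)
  exact pow_le_pow_left₀ (by linarith) (by linarith) 2

lemma one_sub_exp_sq_le_gg {y : ℝ} (hy : 0 ≤ y) : (1 - Real.exp (-y)) ^ 2 ≤ 4 * gg y := by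
  rcases le_total y 2 with h | h
  · linarith [one_sub_exp_sq_le hy, sq_le_gg h]
  · have h2 := Real.exp_le_one_iff.2 (neg_nonpos.2 hy)
    have h3 := Real.exp_pos (-y)
    unfold gg
    nlinarith

lemma gg_mono {x y : ℝ} (hx : 0 ≤ x) (hxy : x ≤ y) : gg x ≤ gg y := by
  unfold gg
  have h1 : Real.exp (-y) = Real.exp (-x) * Real.exp (-(y - x)) := by
    rw [← Real.exp_add]; congr 1; ring
  have h2 := Real.exp_le_one_iff.2 (neg_nonpos.2 hx)
  have h3 := Real.add_one_le_exp (-(y - x))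
  have h4 := Real.exp_pos (-x)
  rw [h1]
  nlinarith

lemma gg_two {y : ℝ} (hy : 0 ≤ y) : gg (2 * y) ≤ 6 * gg y := by
  have h := one_sub_exp_sq_le_gg hy
  have h2 : Real.exp (-(2 * y)) = Real.exp (-y) ^ 2 := by
    rw [← Real.exp_nat_mul]; congr 1; push_cast; ring
  unfold gg at *
  rw [h2]
  nlinarith

lemma gg_diff {x y : ℝ} :
    gg (x + y) + gg (x - y) - 2 * gg x = Real.exp (-(x - y)) * (1 - Real.exp (-y)) ^ 2 := by
  have h1 : Real.exp (-(x + y)) = Real.exp (-(x - y)) * Real.exp (-y) ^ 2 := by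
    rw [← Real.exp_nat_mul, ← Real.exp_add]; congr 1; push_cast; ring
  have h2 : Real.exp (-x) = Real.exp (-(x - y)) * Real.exp (-y) := by
    rw [← Real.exp_add]; congr 1; ring
  unfold gg
  rw [h1, h2]; ring

noncomputable def DD (x y : ℝ) : ℝ := gg |x + y| + gg |x - y| - 2 * gg |x|

lemma DD_abs (x y : ℝ) : DD x y = DD |x| y := by
  rcases le_total 0 x with h | h
  · rw [abs_of_nonneg h]
  · rw [abs_of_nonpos h]
    unfold DD
    rw [abs_neg, show -x + y = -(x - y) by ring, show -x - y = -(x + y) by ring, abs_neg, abs_neg]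
    ring

lemma DD_le (x : ℝ) {y : ℝ} (hy : 0 ≤ y) : |DD x y| ≤ 9 * gg y := by
  rw [DD_abs]
  have hx : 0 ≤ |x| := abs_nonneg x
  generalize |x| = x at hx
  have g0 := gg_nonneg y
  rcases le_total y x with h | h
  · have : DD x y = Real.exp (-(x - y)) * (1 - Real.exp (-y)) ^ 2 := by
      unfold DD
      rw [abs_of_nonneg (by linarith), abs_of_nonneg (by linarith), abs_of_nonneg hx, gg_diff]
    rw [this, abs_of_nonneg (by positivity)]
    have h1 := one_sub_exp_sq_le_gg hy
    have h2 : Real.exp (-(x - y)) ≤ 1 := Real.exp_le_one_iff.2 (by linarith)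
    have h3 : 0 ≤ (1 - Real.exp (-y)) ^ 2 := by positivity
    nlinarith
  · have h1 : gg |x + y| ≤ 6 * gg y := by
      rw [abs_of_nonneg (by linarith)]
      exact (gg_mono (by linarith) (by linarith)).trans (gg_two hy)
    have h2 : gg |x - y| ≤ gg y :=
      gg_mono (abs_nonneg _) (by rw [abs_le]; constructor <;> linarith)
    have h3 : gg |x| ≤ gg y := by rw [abs_of_nonneg hx]; exact gg_mono hx h
    have := gg_nonneg |x + y|
    have := gg_nonneg |x - y|
    have := gg_nonneg |x|
    unfold DD
    rw [abs_le]; constructor <;> linarith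

lemma DD_le' {x y : ℝ} (hy : 0 ≤ y) (hxy : 2 * y ≤ |x|) :
    |DD x y| ≤ y ^ 2 * Real.exp (-(|x| / 2)) := by
  rw [DD_abs]
  have hx : 0 ≤ |x| := abs_nonneg x
  generalize |x| = x at hx hxy
  have : DD x y = Real.exp (-(x - y)) * (1 - Real.exp (-y)) ^ 2 := by
    unfold DD
    rw [abs_of_nonneg (by linarith), abs_of_nonneg (by linarith), abs_of_nonneg hx, gg_diff]
  rw [this, abs_of_nonneg (by positivity), mul_comm]
  exact mul_le_mul (one_sub_exp_sq_le hy) (Real.exp_le_exp.2 (by linarith)) (by positivity)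
    (by positivity)

lemma lam_rpow {a b : ℝ} (ha0 : 0 < a) (hb : 0 < b) (p : ℝ) (j : ℤ) :
    (b * a ^ j) ^ p = b ^ p * (a ^ p) ^ j := by
  rw [Real.mul_rpow hb.le (by positivity), ← Real.rpow_intCast, ← Real.rpow_intCast,
    ← Real.rpow_mul ha0.le, ← Real.rpow_mul ha0.le, mul_comm p]

lemma summable_aux {a b H : ℝ} (ha0 : 0 < a) (ha1 : a < 1) (hb : 0 < b) (hH1 : 1 / 2 < H)
    (hH2 : H < 1) (C : ℝ) (f : ℤ → ℝ) (h0 : ∀ j, 0 ≤ f j)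
    (h1 : ∀ j, f j ≤ C * (b * a ^ j) ^ (2 - 2 * H))
    (h2 : ∀ j, f j ≤ C * (b * a ^ j) ^ (1 - 2 * H)) : Summable f := by
  apply Summable.of_nat_of_neg
  · refine Summable.of_nonneg_of_le (fun n => h0 _) (fun n => h1 _) ?_
    simp_rw [lam_rpow ha0 hb, zpow_natCast]
    exact ((summable_geometric_of_lt_one (by positivity)
      (Real.rpow_lt_one ha0.le ha1 (by linarith))).mul_left _).mul_left _
  · refine Summable.of_nonneg_of_le (fun n => h0 _) (fun n => h2 _) ?_
    simp_rw [lam_rpow ha0 hb, zpow_neg, zpow_natCast, ← inv_pow, ← Real.rpow_neg ha0.le]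
    exact ((summable_geometric_of_lt_one (by positivity)
      (Real.rpow_lt_one ha0.le ha1 (by linarith))).mul_left _).mul_left _

noncomputable def ww (a b H u : ℝ) (j : ℤ) : ℝ := (b * a ^ j) ^ (-(2 * H)) * gg (b * a ^ j * |u|)

lemma summable_ww {a b H : ℝ} (ha0 : 0 < a) (ha1 : a < 1) (hb : 0 < b) (hH1 : 1 / 2 < H)
    (hH2 : H < 1) (u : ℝ) : Summable (ww a b H u) := by
  refine summable_aux ha0 ha1 hb hH1 hH2 (|u| + |u| ^ 2) _ ?_ ?_ ?_
  · intro j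
    exact mul_nonneg (by positivity) (gg_nonneg _)
  · intro j
    have hl : 0 < b * a ^ j := by positivity
    have e : (b * a ^ j) ^ (2 - 2 * H) = (b * a ^ j) ^ (-(2 * H)) * (b * a ^ j) ^ 2 := by
      rw [show 2 - 2 * H = -(2 * H) + (2 : ℕ) by push_cast; ring, Real.rpow_add_natCast hl.ne']
    rw [e]
    unfold ww
    generalize b * a ^ j = l at *
    have h := gg_le_sq (x := l * |u|) (by positivity)
    calc l ^ (-(2 * H)) * gg (l * |u|) ≤ l ^ (-(2 * H)) * ((|u| + |u| ^ 2) * l ^ 2) := by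
          gcongr
          nlinarith [mul_nonneg (abs_nonneg u) (sq_nonneg l)]
      _ = _ := by ring
  · intro j
    have hl : 0 < b * a ^ j := by positivity
    have e : (b * a ^ j) ^ (1 - 2 * H) = (b * a ^ j) ^ (-(2 * H)) * (b * a ^ j) := by
      rw [show 1 - 2 * H = -(2 * H) + 1 by ring, Real.rpow_add_one hl.ne']
    rw [e]
    unfold ww
    generalize b * a ^ j = l at *
    have h := gg_le_self (x := l * |u|) (by positivity)
    calc l ^ (-(2 * H)) * gg (l * |u|) ≤ l ^ (-(2 * H)) * ((|u| + |u| ^ 2) * l) := by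
          gcongr
          nlinarith [mul_nonneg (sq_nonneg |u|) hl.le]
      _ = _ := by ring

lemma summable_kk {a b H : ℝ} (ha0 : 0 < a) (ha1 : a < 1) (hb : 0 < b) (hH1 : 1 / 2 < H)
    (hH2 : H < 1) {δ : ℝ} (hδ : 0 < δ) :
    Summable (fun j : ℤ => (b * a ^ j) ^ (-(2 * H)) *
      ((b * a ^ j) ^ 2 * Real.exp (-(b * a ^ j * δ / 2)))) := by
  refine summable_aux ha0 ha1 hb hH1 hH2 (1 + 2 / δ) _ ?_ ?_ ?_
  · intro j
    positivity
  · intro j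
    have hl : 0 < b * a ^ j := by positivity
    have e : (b * a ^ j) ^ (2 - 2 * H) = (b * a ^ j) ^ (-(2 * H)) * (b * a ^ j) ^ 2 := by
      rw [show 2 - 2 * H = -(2 * H) + (2 : ℕ) by push_cast; ring, Real.rpow_add_natCast hl.ne']
    rw [e]
    generalize b * a ^ j = l at *
    have h : Real.exp (-(l * δ / 2)) ≤ 1 + 2 / δ := by
      have : Real.exp (-(l * δ / 2)) ≤ 1 := Real.exp_le_one_iff.2 (by
        have : 0 < l * δ / 2 := by positivity
        linarith)
      have : 0 < 2 / δ := by positivity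
      linarith
    calc l ^ (-(2 * H)) * (l ^ 2 * Real.exp (-(l * δ / 2)))
        ≤ l ^ (-(2 * H)) * (l ^ 2 * (1 + 2 / δ)) := by gcongr
      _ = _ := by ring
  · intro j
    have hl : 0 < b * a ^ j := by positivity
    have e : (b * a ^ j) ^ (1 - 2 * H) = (b * a ^ j) ^ (-(2 * H)) * (b * a ^ j) := by
      rw [show 1 - 2 * H = -(2 * H) + 1 by ring, Real.rpow_add_one hl.ne']
    rw [e]
    generalize b * a ^ j = l at *
    have h : l * Real.exp (-(l * δ / 2)) ≤ 1 + 2 / δ := by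
      have hz : 0 < l * δ / 2 := by positivity
      have h1 := Real.add_one_le_exp (l * δ / 2)
      have h2 : Real.exp (-(l * δ / 2)) ≤ (l * δ / 2)⁻¹ := by
        rw [Real.exp_neg]
        exact inv_anti₀ hz (by linarith)
      calc l * Real.exp (-(l * δ / 2)) ≤ l * (l * δ / 2)⁻¹ := by gcongr
        _ = 2 / δ := by field_simp
        _ ≤ _ := by linarith
    calc l ^ (-(2 * H)) * (l ^ 2 * Real.exp (-(l * δ / 2)))
        = l ^ (-(2 * H)) * l * (l * Real.exp (-(l * δ / 2))) := by ring
      _ ≤ l ^ (-(2 * H)) * l * (1 + 2 / δ) := by gcongr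
      _ = _ := by ring

noncomputable def VV (a b H u : ℝ) : ℝ := ∑' j, ww a b H u j

lemma VV_eq {a b H : ℝ} (ha0 : 0 < a) (hb : 0 < b) (hH1 : 1 / 2 < H) (u : ℝ) :
    |u| ^ (2 * H) * hosc a b H |u| = VV a b H u := by
  unfold VV hosc
  rw [← tsum_mul_left]
  congr 1
  ext j
  unfold ww gg
  rcases eq_or_ne u 0 with rfl | hu
  · simp [Real.zero_rpow (show 2 * H ≠ 0 by linarith)]
  · have hu' : 0 < |u| := abs_pos.2 hu
    have hl : 0 < b * a ^ j := by positivity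
    rw [Real.mul_rpow hl.le hu'.le, Real.rpow_neg hu'.le]
    have : |u| ^ (2 * H) ≠ 0 := by positivity
    field_simp

lemma VV_lower {a b H : ℝ} (ha0 : 0 < a) (ha1 : a < 1) (hb : 0 < b) (hH1 : 1 / 2 < H)
    (hH2 : H < 1) (L : ℝ) :
    ∃ ε₀ > 0, ∀ ε, 0 < ε → ε ≤ ε₀ → L * ε ^ 2 ≤ VV a b H ε := by
  have hp : 1 < a ^ (-(2 - 2 * H)) := Real.one_lt_rpow_of_pos_of_lt_one_of_neg ha0 ha1 (by linarith)
  obtain ⟨n, hn⟩ := pow_unbounded_of_one_lt (4 * L / b ^ (2 - 2 * H)) hp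
  have hl : 0 < b * a ^ (-(n : ℤ)) := by positivity
  have hL : 4 * L ≤ (b * a ^ (-(n : ℤ))) ^ (2 - 2 * H) := by
    rw [lam_rpow ha0 hb, zpow_neg, zpow_natCast, ← inv_pow, ← Real.rpow_neg ha0.le]
    rw [div_lt_iff₀ (by positivity)] at hn
    linarith
  refine ⟨2 / (b * a ^ (-(n : ℤ))), by positivity, fun ε h0 h1 => ?_⟩
  have h2 : ww a b H ε (-(n : ℤ)) ≤ VV a b H ε :=
    (summable_ww ha0 ha1 hb hH1 hH2 ε).le_tsum _
      (fun j _ => mul_nonneg (by positivity) (gg_nonneg _))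
  refine le_trans ?_ h2
  unfold ww
  have e : (b * a ^ (-(n : ℤ))) ^ (2 - 2 * H)
      = (b * a ^ (-(n : ℤ))) ^ (-(2 * H)) * (b * a ^ (-(n : ℤ))) ^ 2 := by
    rw [show 2 - 2 * H = -(2 * H) + (2 : ℕ) by push_cast; ring, Real.rpow_add_natCast hl.ne']
  rw [e] at hL
  rw [abs_of_pos h0]
  generalize b * a ^ (-(n : ℤ)) = l at *
  rw [le_div_iff₀ hl] at h1
  have h3 := sq_le_gg (x := l * ε) (by linarith)
  calc L * ε ^ 2 ≤ l ^ (-(2 * H)) * ((l * ε) ^ 2 / 4) := by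
        nlinarith [sq_nonneg ε]
    _ ≤ _ := by gcongr

lemma Ieps_eq {a b H : ℝ} (ha0 : 0 < a) (ha1 : a < 1) (hb : 0 < b) (hH1 : 1 / 2 < H)
    (hH2 : H < 1) {ε : ℝ} (hε : 0 < ε) (s t : ℝ) :
    Ieps a b H ε s t = (VV a b H ε)⁻¹ * ((1 / 2) * ∑' j : ℤ, (b * a ^ j) ^ (-(2 * H)) *
      DD (b * a ^ j * (s - t)) (b * a ^ j * ε)) := by
  have h1 : ∑' j : ℤ, (b * a ^ j) ^ (-(2 * H)) * DD (b * a ^ j * (s - t)) (b * a ^ j * ε)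
      = VV a b H (s - t + ε) + VV a b H (s - t - ε) - 2 * VV a b H (s - t) := by
    unfold VV
    have S := summable_ww ha0 ha1 hb hH1 hH2
    rw [← tsum_mul_left, ← (S _).tsum_add (S _), ← ((S _).add (S _)).tsum_sub ((S _).mul_left _)]
    congr 1
    ext j
    have hl : 0 < b * a ^ j := by positivity
    unfold ww DD
    rw [← mul_add, ← mul_sub]
    simp only [abs_mul (b * a ^ j), abs_of_pos hl]
    ring
  have h2 : ε ^ (2 * H) * hosc a b H ε = VV a b H ε := by
    rw [← VV_eq ha0 hb hH1, abs_of_pos hε]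
  rw [h1]
  unfold Ieps
  rw [h2]
  unfold Rcov
  rw [VV_eq ha0 hb hH1, VV_eq ha0 hb hH1, VV_eq ha0 hb hH1, VV_eq ha0 hb hH1]
  rw [show s + ε - (t + ε) = s - t by ring, show s + ε - t = s - t + ε by ring,
    show s - (t + ε) = s - t - ε by ring]
  ring

lemma Ieps_le {a b H : ℝ} (ha0 : 0 < a) (ha1 : a < 1) (hb : 0 < b) (hH1 : 1 / 2 < H)
    (hH2 : H < 1) {ε : ℝ} (hε : 0 < ε) (hV : 0 < VV a b H ε) (s t : ℝ) :
    |Ieps a b H ε s t| ≤ 5 := by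
  rw [Ieps_eq ha0 ha1 hb hH1 hH2 hε, abs_mul, abs_mul, abs_inv, abs_of_pos hV,
    inv_mul_le_iff₀ hV, abs_of_pos (by norm_num : (0:ℝ) < 1 / 2)]
  have : ‖∑' j : ℤ, (b * a ^ j) ^ (-(2 * H)) * DD (b * a ^ j * (s - t)) (b * a ^ j * ε)‖
      ≤ 9 * VV a b H ε := by
    refine tsum_of_norm_bounded ((summable_ww ha0 ha1 hb hH1 hH2 ε).hasSum.mul_left 9) ?_
    intro j
    have hl : 0 < b * a ^ j := by positivity
    have := DD_le (b * a ^ j * (s - t)) (y := b * a ^ j * ε) (by positivity)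
    unfold ww
    rw [Real.norm_eq_abs, abs_mul, abs_of_pos (by positivity : 0 < (b * a ^ j) ^ (-(2 * H))),
      abs_of_pos hε]
    calc _ ≤ (b * a ^ j) ^ (-(2 * H)) * (9 * gg (b * a ^ j * ε)) := by gcongr
      _ = _ := by ring
  rw [Real.norm_eq_abs] at this
  linarith

lemma Ieps_le' {a b H : ℝ} (ha0 : 0 < a) (ha1 : a < 1) (hb : 0 < b) (hH1 : 1 / 2 < H)
    (hH2 : H < 1) {δ : ℝ} (hδ : 0 < δ) : ∃ K : ℝ, 0 ≤ K ∧ ∀ ε s t : ℝ, 0 < ε → 2 * ε ≤ δ →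
    δ ≤ |s - t| → 0 < VV a b H ε → |Ieps a b H ε s t| ≤ K * ε ^ 2 / VV a b H ε := by
  refine ⟨∑' j : ℤ, (b * a ^ j) ^ (-(2 * H)) *
      ((b * a ^ j) ^ 2 * Real.exp (-(b * a ^ j * δ / 2))), tsum_nonneg (fun j => by positivity), ?_⟩
  intro ε s t hε hεδ hst hV
  have S := summable_kk ha0 ha1 hb hH1 hH2 hδ
  rw [Ieps_eq ha0 ha1 hb hH1 hH2 hε, abs_mul, abs_mul, abs_inv, abs_of_pos hV,
    inv_mul_le_iff₀ hV, abs_of_pos (by norm_num : (0:ℝ) < 1 / 2), mul_div_cancel₀ _ hV.ne']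
  have : ‖∑' j : ℤ, (b * a ^ j) ^ (-(2 * H)) * DD (b * a ^ j * (s - t)) (b * a ^ j * ε)‖
      ≤ (∑' j : ℤ, (b * a ^ j) ^ (-(2 * H)) *
      ((b * a ^ j) ^ 2 * Real.exp (-(b * a ^ j * δ / 2)))) * ε ^ 2 := by
    refine tsum_of_norm_bounded (S.hasSum.mul_right _) ?_
    intro j
    have hl : 0 < b * a ^ j := by positivity
    have e : |b * a ^ j * (s - t)| = b * a ^ j * |s - t| := by rw [abs_mul, abs_of_pos hl]
    have := DD_le' (x := b * a ^ j * (s - t)) (y := b * a ^ j * ε) (by positivity) (by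
      rw [e]; nlinarith)
    rw [e] at this
    rw [Real.norm_eq_abs, abs_mul, abs_of_pos (by positivity : 0 < (b * a ^ j) ^ (-(2 * H)))]
    calc _ ≤ (b * a ^ j) ^ (-(2 * H)) *
          ((b * a ^ j * ε) ^ 2 * Real.exp (-(b * a ^ j * |s - t| / 2))) := by gcongr
      _ ≤ (b * a ^ j) ^ (-(2 * H)) *
          ((b * a ^ j * ε) ^ 2 * Real.exp (-(b * a ^ j * δ / 2))) := by gcongr
      _ = _ := by ring
  rw [Real.norm_eq_abs] at this
  have h0 := abs_nonneg (∑' j : ℤ, (b * a ^ j) ^ (-(2 * H)) *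
    DD (b * a ^ j * (s - t)) (b * a ^ j * ε))
  linarith

lemma inner_le {T δ η s : ℝ} (hT : 0 < T) (hδ : 0 < δ) (f : ℝ → ℝ)
    (h1 : ∀ t, |f t| ≤ 5) (h2 : ∀ t, δ ≤ |s - t| → |f t| ≤ η) :
    ‖∫ t in (0:ℝ)..T, (f t) ^ 2‖ ≤ 50 * δ + T * η ^ 2 := by
  have hi1 : Integrable ((Set.Ioo (s - δ) (s + δ)).indicator (fun _ : ℝ => (25:ℝ))) :=
    (integrable_indicator_iff measurableSet_Ioo).2 (by
      apply integrableOn_const (by simp))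
  have hi : IntervalIntegrable (fun t => (Set.Ioo (s - δ) (s + δ)).indicator (fun _ => (25:ℝ)) t
      + η ^ 2) volume 0 T := hi1.intervalIntegrable.add intervalIntegrable_const
  refine (intervalIntegral.norm_integral_le_of_norm_le hT.le
    (Filter.Eventually.of_forall fun t _ => ?_) hi).trans ?_
  · rw [Real.norm_eq_abs, abs_of_nonneg (sq_nonneg _), ← sq_abs]
    by_cases ht : t ∈ Set.Ioo (s - δ) (s + δ)
    · rw [Set.indicator_of_mem ht]
      have := pow_le_pow_left₀ (abs_nonneg _) (h1 t) 2
      nlinarith [sq_nonneg η]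
    · rw [Set.indicator_of_notMem ht]
      have : δ ≤ |s - t| := by
        by_contra hc
        push Not at hc
        rw [abs_lt] at hc
        exact ht ⟨by linarith, by linarith⟩
      have := pow_le_pow_left₀ (abs_nonneg _) (h2 t this) 2
      linarith
  · rw [intervalIntegral.integral_add hi1.intervalIntegrable intervalIntegrable_const,
      intervalIntegral.integral_const, smul_eq_mul, sub_zero]
    gcongr
    rw [intervalIntegral.integral_of_le hT.le]
    refine (setIntegral_le_integral hi1 (Filter.Eventually.of_forall fun t =>
      Set.indicator_nonneg (fun _ _ => by norm_num) t)).trans ?_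
    rw [integral_indicator measurableSet_Ioo, setIntegral_const, smul_eq_mul, measureReal_def,
      Real.volume_Ioo, ENNReal.toReal_ofReal (by linarith)]
    linarith

theorem stmt18 (a b : ℝ) (ha0 : 0 < a) (ha1 : a < 1) (hb : 0 < b)
    (H : ℝ) (hH1 : 1 / 2 < H) (hH2 : H < 1) (T : ℝ) (hT : 0 < T) :
    Filter.Tendsto
      (fun ε : ℝ => ∫ s in (0:ℝ)..T, ∫ t in (0:ℝ)..T, (Ieps a b H ε s t) ^ 2)
      (nhdsWithin 0 (Set.Ioi 0)) (nhds 0) := by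
  rw [Metric.tendsto_nhds]
  intro e he
  obtain ⟨δ, hδ, hδe⟩ : ∃ δ : ℝ, 0 < δ ∧ 50 * δ * T = e / 4 :=
    ⟨e / (200 * T), by positivity, by field_simp; norm_num⟩
  obtain ⟨η, hη, hηe⟩ : ∃ η : ℝ, 0 < η ∧ T * η ^ 2 * T = e / 4 := by
    refine ⟨Real.sqrt e / (2 * T), by positivity, ?_⟩
    rw [div_pow, Real.sq_sqrt he.le]
    field_simp
    norm_num
  obtain ⟨K, hK, hKb⟩ := Ieps_le' (b := b) ha0 ha1 hb hH1 hH2 hδ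
  obtain ⟨ε₀, hε₀, hV⟩ := VV_lower (b := b) ha0 ha1 hb hH1 hH2 (K / η + 1)
  have hmem : Set.Ioo (0:ℝ) (min ε₀ (δ / 2)) ∈ nhdsWithin (0:ℝ) (Set.Ioi 0) :=
    Ioo_mem_nhdsGT (by positivity)
  filter_upwards [hmem] with ε hε
  have hε0 : 0 < ε := hε.1
  have hε1 : ε ≤ ε₀ := (hε.2.trans_le (min_le_left _ _)).le
  have hε2 : 2 * ε ≤ δ := by linarith [hε.2.trans_le (min_le_right _ _)]
  have hVε := hV ε hε0 hε1
  have hVpos : 0 < VV a b H ε := lt_of_lt_of_le (by positivity) hVε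
  have hin : ∀ s, ‖∫ t in (0:ℝ)..T, (Ieps a b H ε s t) ^ 2‖ ≤ 50 * δ + T * η ^ 2 := by
    intro s
    refine inner_le (s := s) hT hδ _ (fun t => Ieps_le ha0 ha1 hb hH1 hH2 hε0 hVpos s t) ?_
    intro t hst
    refine (hKb ε s t hε0 hε2 hst hVpos).trans ?_
    rw [div_le_iff₀ hVpos]
    have h3 : η * ((K / η + 1) * ε ^ 2) = K * ε ^ 2 + η * ε ^ 2 := by field_simp
    have h4 := mul_le_mul_of_nonneg_left hVε hη.le
    have h5 : 0 < η * ε ^ 2 := by positivity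
    linarith
  rw [dist_zero_right]
  have := intervalIntegral.norm_integral_le_of_norm_le_const (a := 0) (b := T) (fun s _ => hin s)
  rw [sub_zero, abs_of_pos hT] at this
  linarith
end
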